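/- Let γ ≠ 1 be a real number. Given two Euler states with densities ρ± > 0, velocities (v₁±, v₂±, v₃±), and pressures p± > 0, set β± := ρ±/(2p±). Define the Ranocha flux F₁ ∈ ℝ⁵ by F₁^{(1)} = ρˡⁿ·{v₁}, F₁^{(2)} = ρˡⁿ·{v₁}² + {p}, F₁^{(3)} = ρˡⁿ·{v₁}·{v₂}, F₁^{(4)} = ρˡⁿ·{v₁}·{v₃}, and F₁^{(5)} = (ρˡⁿ·({v₁}² + {v₂}² + {v₃}² − ½({v₁²} + {v₂²} + {v₃²})) + ρˡⁿ/((γ−1)·(ρ/p)ˡⁿ))·{v₁} + 2{p}·{v₁} − {p·v₁}, where (ρ/p)ˡⁿ is the logarithmic mean of ρ₋/p₋ and ρ₊/p₊ and {p·v₁} := (p₊v₁₊ + p₋v₁₋)/2. Then F₁ satisfies Tadmor's discrete entropy conservation condition in the x-direction: ⟦w⟧ · F₁ = ⟦ρ·v₁⟧, where w denotes the Euler entropy variables evaluated at the two states. -/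

import Mathlib

open Matrix

/-- Logarithmic mean of two positive reals: `(a₊ − a₋)/(ln a₊ − ln a₋)` if `a₊ ≠ a₋`,
and `a₋` otherwise. -/
noncomputable def logMean (am ap : ℝ) : ℝ :=
  if ap = am then am else (ap - am) / (Real.log ap - Real.log am)

/-- Entropy variables for the compressible Euler equations with adiabatic constant `γ`,
for a state `(ρ, v₁, v₂, v₃, β)`, where `ς = −(γ−1)·ln ρ − ln β − ln 2`. -/
noncomputable def eulerW (γ ρ v1 v2 v3 β : ℝ) : Fin 5 → ℝ :=
  ![(γ - (-(γ - 1) * Real.log ρ - Real.log β - Real.log 2)) / (γ - 1)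
      - β * (v1 ^ 2 + v2 ^ 2 + v3 ^ 2),
    2 * β * v1, 2 * β * v2, 2 * β * v3, -(2 * β)]

theorem logMean_mul {a b : ℝ} (ha : 0 < a) (hb : 0 < b) :
    logMean a b * (Real.log b - Real.log a) = b - a ∧ logMean a b ≠ 0 := by
  unfold logMean
  split_ifs with h
  · subst h
    exact ⟨by ring, ha.ne'⟩
  · have h1 : Real.log b - Real.log a ≠ 0 := fun h2 =>
      h (Real.log_injOn_pos hb ha (sub_eq_zero.mp h2))
    exact ⟨div_mul_cancel₀ _ h1, div_ne_zero (sub_ne_zero.mpr h) h1⟩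

/-- Ranocha's entropy conservative and kinetic energy preserving flux in the `x`-direction
satisfies Tadmor's discrete entropy conservation condition `⟦w⟧ · F₁ = ⟦ρ·v₁⟧`, where
`β_± = ρ_±/(2 p_±)`. -/
theorem ranocha_flux_entropy_conservative
    (γ ρm v1m v2m v3m pm ρp v1p v2p v3p pp : ℝ)
    (hγ : γ ≠ 1) (hρm : 0 < ρm) (hρp : 0 < ρp) (hpm : 0 < pm) (hpp : 0 < pp) :
    (eulerW γ ρp v1p v2p v3p (ρp / (2 * pp)) - eulerW γ ρm v1m v2m v3m (ρm / (2 * pm))) ⬝ᵥ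
      ![logMean ρm ρp * ((v1p + v1m) / 2),
        logMean ρm ρp * ((v1p + v1m) / 2) ^ 2 + (pp + pm) / 2,
        logMean ρm ρp * ((v1p + v1m) / 2) * ((v2p + v2m) / 2),
        logMean ρm ρp * ((v1p + v1m) / 2) * ((v3p + v3m) / 2),
        (logMean ρm ρp *
            (((v1p + v1m) / 2) ^ 2 + ((v2p + v2m) / 2) ^ 2 + ((v3p + v3m) / 2) ^ 2
              - (1 / 2) * ((v1p ^ 2 + v1m ^ 2) / 2 + (v2p ^ 2 + v2m ^ 2) / 2
                + (v3p ^ 2 + v3m ^ 2) / 2))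
          + logMean ρm ρp / ((γ - 1) * logMean (ρm / pm) (ρp / pp))) * ((v1p + v1m) / 2)
          + 2 * ((pp + pm) / 2) * ((v1p + v1m) / 2) - (pp * v1p + pm * v1m) / 2]
      = ρp * v1p - ρm * v1m := by
  obtain ⟨hL, -⟩ := logMean_mul hρm hρp
  obtain ⟨hM, hM0⟩ := logMean_mul (div_pos hρm hpm) (div_pos hρp hpp)
  have hg : γ - 1 ≠ 0 := sub_ne_zero.mpr hγ
  have e : ∀ r p : ℝ, 0 < r → 0 < p → Real.log (r / (2 * p)) = Real.log (r / p) - Real.log 2 := by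
    intro r p hr hp
    rw [← Real.log_div (div_pos hr hp).ne' two_ne_zero, div_div, mul_comm p 2]
  have f : ∀ r p : ℝ, r / (2 * p) = r / p / 2 := by
    intro r p
    rw [div_div, mul_comm p 2]
  have ep := e ρp pp hρp hpp
  have em := e ρm pm hρm hpm
  have rp : ρp = ρp / pp * pp := (div_mul_cancel₀ _ hpp.ne').symm
  have rm : ρm = ρm / pm * pm := (div_mul_cancel₀ _ hpm.ne').symm
  simp only [eulerW, dotProduct, Fin.sum_univ_five, Pi.sub_apply, ep, em]
  simp only [f]
  simp
  generalize logMean ρm ρp = L at *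
  generalize logMean (ρm / pm) (ρp / pp) = M at *
  generalize Real.log (ρp / pp) = lbp at *
  generalize Real.log (ρm / pm) = lbm at *
  generalize Real.log ρp = lp at *
  generalize Real.log ρm = lm at *
  generalize ρp / pp = bp at *
  generalize ρm / pm = bm at *
  clear e f ep em
  generalize Real.log 2 = l2 at *
  obtain rfl : bp = M * (lbp - lbm) + bm := by linarith
  field_simp
  subst rp rm
  linear_combination (4 * M * (γ - 1) * (v1p + v1m)) * hL
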